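/- Let ν, a, s ∈ ℝ with 0 < |ν| ≤ 1, and let x be a solution of the class-D equation with parameters (ν, a, s) that is not a constant function. Then for every t₀ ∈ ℝ the strict inequalities 2π(a − 1) < x(t₀ + 2π) − x(t₀) < 2π(a + 1) hold. -/

import Mathlib

open Real

/-- A solution of the class-D equation `ẋ = ν sin x + a + s sin t`. -/
def IsClassDSolution (ν a s : ℝ) (x : ℝ → ℝ) : Prop :=
  ∀ t : ℝ, HasDerivAt x (ν * Real.sin (x t) + a + s * Real.sin t) t

/-- Reflecting a solution, `x ↦ -x`, negates the parameters `a` and `s`. -/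
lemma IsClassDSolution.neg {ν a s : ℝ} {x : ℝ → ℝ} (hx : IsClassDSolution ν a s x) :
    IsClassDSolution ν (-a) (-s) (fun t => -x t) := fun t =>
  (hx t).neg.congr_deriv (by rw [Real.sin_neg]; ring)

/-- Without forcing, a solution passing through an equilibrium is constant. -/
lemma IsClassDSolution.eq_const_of_equilibrium {ν a : ℝ} {x : ℝ → ℝ}
    (hx : IsClassDSolution ν a 0 x) {t₁ : ℝ} (h : ν * Real.sin (x t₁) + a = 0) (t : ℝ) :
    x t = x t₁ := by
  have hlip : LipschitzWith (Real.nnabs ν) (fun y : ℝ => ν * Real.sin y + a) := by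
    refine LipschitzWith.of_dist_le_mul fun y z => ?_
    have hs : |Real.sin y - Real.sin z| ≤ |y - z| := by
      simpa [Real.dist_eq] using Real.lipschitzWith_sin.dist_le_mul y z
    rw [Real.dist_eq, Real.dist_eq, Real.coe_nnabs, add_sub_add_right_eq_sub, ← mul_sub, abs_mul]
    exact mul_le_mul_of_nonneg_left hs (abs_nonneg ν)
  have huniq := ODE_solution_unique_univ (v := fun _ y => ν * Real.sin y + a)
    (s := fun _ => Set.univ) (K := Real.nnabs ν) (f := x) (g := fun _ => x t₁) (t₀ := t₁)
    (fun _ => hlip.lipschitzOnWith)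
    (fun u => ⟨(hx u).congr_deriv (by ring), Set.mem_univ _⟩)
    (fun u => ⟨(hasDerivAt_const u (x t₁)).congr_deriv h.symm, Set.mem_univ _⟩) rfl
  exact congrFun huniq t

/-- If `ν sin x = 1` with `|ν| ≤ 1` along an open set of times, then `x` is stationary there. -/
lemma IsClassDSolution.deriv_eq_zero_of_mul_sin_eq_one {ν a s : ℝ} (hν : |ν| ≤ 1) {x : ℝ → ℝ}
    (hx : IsClassDSolution ν a s x) {U : Set ℝ} (hU : IsOpen U)
    (h : ∀ t ∈ U, ν * Real.sin (x t) = 1) {t : ℝ} (ht : t ∈ U) :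
    1 + a + s * Real.sin t = 0 := by
  have hcos : ∀ u ∈ U, Real.cos (x u) = 0 := by
    intro u hu
    have h1 : ν ^ 2 * Real.sin (x u) ^ 2 = 1 := by rw [← mul_pow, h u hu, one_pow]
    have h2 : ν ^ 2 ≤ 1 := (sq_le_one_iff_abs_le_one ν).2 hν
    have h3 := Real.sin_sq_add_cos_sq (x u)
    have h4 : Real.cos (x u) ^ 2 = 0 := by
      nlinarith [sq_nonneg (Real.cos (x u)), sq_nonneg (Real.sin (x u))]
    exact pow_eq_zero_iff two_ne_zero |>.1 h4
  have hzero : HasDerivAt (fun u => Real.cos (x u)) 0 t :=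
    (hasDerivAt_const t (0 : ℝ)).congr_of_eventuallyEq
      (Filter.eventually_of_mem (hU.mem_nhds ht) hcos)
  have hprod := (hx t).cos.unique hzero
  have hsin : Real.sin (x t) ≠ 0 := fun h0 => by simpa [h0] using h t ht
  rw [h t ht] at hprod
  simpa [hsin] using hprod

/-- A nonconstant solution with `|ν| ≤ 1` grows by less than `2π(a + 1)` over a period. -/
lemma IsClassDSolution.increment_lt {ν a s : ℝ} (hν : |ν| ≤ 1) {x : ℝ → ℝ}
    (hx : IsClassDSolution ν a s x) (hnc : ¬ ∃ c : ℝ, ∀ t : ℝ, x t = c) (t₀ : ℝ) :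
    x (t₀ + 2 * π) - x t₀ < 2 * π * (a + 1) := by
  by_contra! hge
  have hπ := Real.pi_pos
  set g : ℝ → ℝ := fun t => x t - (a + 1) * t + s * Real.cos t with hg
  have hderiv : ∀ t, HasDerivAt g (ν * Real.sin (x t) - 1) t := fun t =>
    (((hx t).sub ((hasDerivAt_id t).const_mul (a + 1))).add
      ((Real.hasDerivAt_cos t).const_mul s)).congr_deriv (by ring)
  have hanti : Antitone g := antitone_of_hasDerivAt_nonpos hderiv fun t => by
    have : |ν * Real.sin (x t)| ≤ 1 := by
      rw [abs_mul]
      exact mul_le_one₀ hν (abs_nonneg _) (Real.abs_sin_le_one _)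
    simpa using (abs_le.1 this).2
  have hends : g t₀ ≤ g (t₀ + 2 * π) := by
    simp only [hg, Real.cos_add_two_pi]
    linarith
  have hsat : ∀ t ∈ Set.Ioo t₀ (t₀ + 2 * π), ν * Real.sin (x t) = 1 := by
    intro t ht
    have hconst : HasDerivAt g 0 t :=
      (hasDerivAt_const t (g t₀)).congr_of_eventuallyEq
        (Filter.eventually_of_mem (isOpen_Ioo.mem_nhds ht) fun u hu =>
          le_antisymm (hanti hu.1.le) (hends.trans (hanti hu.2.le)))
    exact sub_eq_zero.1 ((hderiv t).unique hconst)
  have hstat : ∀ t ∈ Set.Ioo t₀ (t₀ + 2 * π), 1 + a + s * Real.sin t = 0 := fun t ht =>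
    hx.deriv_eq_zero_of_mul_sin_eq_one hν isOpen_Ioo hsat ht
  have hmid : t₀ + π ∈ Set.Ioo t₀ (t₀ + 2 * π) := ⟨by linarith, by linarith⟩
  have h₁ := hstat (t₀ + π / 2) ⟨by linarith, by linarith⟩
  have h₂ := hstat (t₀ + π) hmid
  have h₃ := hstat (t₀ + π / 2 + π) ⟨by linarith, by linarith⟩
  rw [Real.sin_add_pi_div_two] at h₁
  rw [Real.sin_add_pi] at h₂
  rw [Real.sin_add_pi, Real.sin_add_pi_div_two] at h₃
  have ha : a = -1 := by linarith
  have hs : s = 0 := by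
    have hc : s * Real.cos t₀ = 0 := by linarith
    have hs' : s * Real.sin t₀ = 0 := by linarith
    linear_combination Real.cos t₀ * hc + Real.sin t₀ * hs' - s * Real.sin_sq_add_cos_sq t₀
  subst hs
  exact hnc ⟨x (t₀ + π), hx.eq_const_of_equilibrium (by rw [hsat _ hmid, ha]; norm_num)⟩

/-- If `0 < |ν| ≤ 1` and `x` is a nonconstant solution of the class-D equation, then the
increment of `x` over any interval of length `2π` lies strictly between `2π(a - 1)`
and `2π(a + 1)`. -/
theorem classD_increment_strict_bounds
    (ν a s : ℝ) (hν0 : 0 < |ν|) (hν1 : |ν| ≤ 1)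
    (x : ℝ → ℝ) (hx : IsClassDSolution ν a s x)
    (hnc : ¬ ∃ c : ℝ, ∀ t : ℝ, x t = c) :
    ∀ t₀ : ℝ, 2 * π * (a - 1) < x (t₀ + 2 * π) - x t₀ ∧
      x (t₀ + 2 * π) - x t₀ < 2 * π * (a + 1) := by
  intro t₀
  refine ⟨?_, hx.increment_lt hν1 hnc t₀⟩
  have hneg := hx.neg.increment_lt hν1
    (fun ⟨c, hc⟩ => hnc ⟨-c, fun t => by rw [← hc t, neg_neg]⟩) t₀
  linarith
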